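/- arXiv:1304.5866 — 3 statements merged into one kernel-verified Lean document; each statement's English description precedes it below -/
import Mathlib

section
/- For λ ∈ ℂ and κ > -1, the unique analytic solution f of T_κ f = iλ f with f(0) = 1 is the confluent hypergeometric function f(x) = M(1, κ+1; iλx) = Σ_{n≥0} (iλx)^n / (κ+1)_n. -/
/-- The one-variable Dunkl-type operator with projection term,
extended by continuity at `x = 0` by the value `(1 + κ) f'(0)`. -/
noncomputable def Tkappa (κ : ℂ) (f : ℝ → ℂ) (x : ℝ) : ℂ :=
  if x = 0 then (1 + κ) * deriv f 0 else deriv f x + κ * (f x - f 0) / x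

open Filter Topology

/-- The entire function `M(1, b; z) = ∑ zⁿ / (b)ₙ`. -/
noncomputable def kummerOne (b z : ℂ) : ℂ :=
  ∑' n : ℕ, z ^ n / (ascPochhammer ℂ n).eval b

theorem ascPochhammer_eval_ne_zero {b : ℝ} (hb : 0 < b) (n : ℕ) :
    (ascPochhammer ℂ n).eval (b : ℂ) ≠ 0 := by
  induction n with
  | zero => simp
  | succ n ih =>
    rw [ascPochhammer_succ_eval]
    refine mul_ne_zero ih ?_
    have : (b + n : ℝ) ≠ 0 := by positivity
    exact_mod_cast this

theorem summable_pow_div_ascPochhammer {b : ℝ} (hb : 0 < b) (R : ℝ) :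
    Summable fun n : ℕ => R ^ n / ‖(ascPochhammer ℂ n).eval (b : ℂ)‖ := by
  have hnorm : ∀ n : ℕ, ‖(b : ℂ) + n‖ = b + n := fun n => by
    have : (b : ℂ) + n = ((b + n : ℝ) : ℂ) := by push_cast; rfl
    rw [this, Complex.norm_real, Real.norm_of_nonneg (by positivity)]
  have hlim : Tendsto (fun n : ℕ => |R| / (b + n)) atTop (𝓝 0) :=
    tendsto_const_nhds.div_atTop
      (tendsto_atTop_add_const_left _ _ tendsto_natCast_atTop_atTop)
  refine summable_of_ratio_norm_eventually_le (r := 1 / 2) (by norm_num) ?_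
  filter_upwards [hlim.eventually (gt_mem_nhds (show (0 : ℝ) < 1 / 2 by norm_num))] with n hn
  have hstep : R ^ (n + 1) / ‖(ascPochhammer ℂ (n + 1)).eval (b : ℂ)‖ =
      R / (b + n) * (R ^ n / ‖(ascPochhammer ℂ n).eval (b : ℂ)‖) := by
    rw [ascPochhammer_succ_eval, norm_mul, hnorm, pow_succ, mul_comm (R ^ n), mul_comm ‖_‖,
      mul_div_mul_comm]
  rw [hstep, norm_mul, norm_div, Real.norm_eq_abs R,
    Real.norm_of_nonneg (show (0 : ℝ) ≤ b + n by positivity)]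
  exact mul_le_mul_of_nonneg_right hn.le (norm_nonneg _)

theorem hasSum_kummerOne {b : ℝ} (hb : 0 < b) (z : ℂ) :
    HasSum (fun n : ℕ => z ^ n / (ascPochhammer ℂ n).eval (b : ℂ)) (kummerOne b z) := by
  refine (Summable.of_norm ?_).hasSum
  simpa only [norm_div, norm_pow] using summable_pow_div_ascPochhammer hb ‖z‖

theorem norm_pow_div_ascPochhammer_le (b : ℂ) (R : ℝ) (n : ℕ) (w : ℂ)
    (hw : w ∈ Metric.ball (0 : ℂ) R) :
    ‖w ^ n / (ascPochhammer ℂ n).eval b‖ ≤ R ^ n / ‖(ascPochhammer ℂ n).eval b‖ := by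
  rw [norm_div, norm_pow]
  have := (mem_ball_zero_iff.1 hw).le
  gcongr

theorem differentiable_kummerOne {b : ℝ} (hb : 0 < b) : Differentiable ℂ (kummerOne b) := by
  intro z
  have hd := Complex.differentiableOn_tsum_of_summable_norm
    (F := fun (n : ℕ) (w : ℂ) => w ^ n / (ascPochhammer ℂ n).eval (b : ℂ))
    (summable_pow_div_ascPochhammer hb (‖z‖ + 1))
    (fun n => by fun_prop) Metric.isOpen_ball
    (norm_pow_div_ascPochhammer_le b (‖z‖ + 1))
  exact hd.differentiableAt (Metric.isOpen_ball.mem_nhds (by simp))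

theorem hasSum_deriv_kummerOne {b : ℝ} (hb : 0 < b) (z : ℂ) :
    HasSum (fun n : ℕ => n * z ^ (n - 1) / (ascPochhammer ℂ n).eval (b : ℂ))
      (deriv (kummerOne b) z) := by
  have hd := Complex.hasSum_deriv_of_summable_norm
    (F := fun (n : ℕ) (w : ℂ) => w ^ n / (ascPochhammer ℂ n).eval (b : ℂ))
    (summable_pow_div_ascPochhammer hb (‖z‖ + 1))
    (fun n => by fun_prop) Metric.isOpen_ball
    (norm_pow_div_ascPochhammer_le b (‖z‖ + 1)) (z := z) (by simp)
  simp only [deriv_div_const, deriv_pow_field] at hd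
  exact hd

theorem kummerOne_zero {b : ℝ} (hb : 0 < b) : kummerOne b 0 = 1 := by
  refine (hasSum_kummerOne hb 0).unique ?_
  convert hasSum_single (f := fun n : ℕ => (0 : ℂ) ^ n / (ascPochhammer ℂ n).eval (b : ℂ)) 0 ?_
    using 1
  · simp
  · intro n hn
    simp [hn]

theorem deriv_kummerOne_zero {b : ℝ} (hb : 0 < b) : deriv (kummerOne b) 0 = 1 / b := by
  refine (hasSum_deriv_kummerOne hb 0).unique ?_
  convert hasSum_single
    (f := fun n : ℕ => n * (0 : ℂ) ^ (n - 1) / (ascPochhammer ℂ n).eval (b : ℂ)) 1 ?_ using 1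
  · simp
  · intro n hn
    rcases n with _ | _ | n
    · simp
    · exact absurd rfl hn
    · simp

/-- The first-order differential equation satisfied by `M(1, b; ·)`. -/
theorem kummerOne_ode {b : ℝ} (hb : 0 < b) (z : ℂ) :
    z * deriv (kummerOne b) z + (b - 1) * (kummerOne b z - 1) = z * kummerOne b z := by
  have hlhs := ((hasSum_deriv_kummerOne hb z).mul_left z).add
    ((hasSum_kummerOne hb z).mul_left ((b : ℂ) - 1))
  rw [← hasSum_nat_add_iff' 1] at hlhs
  have hterm := hlhs.unique (((hasSum_kummerOne hb z).mul_left z).congr_fun fun n => ?_)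
  · simp only [Finset.sum_range_one, Nat.cast_zero, pow_zero, ascPochhammer_zero,
      Polynomial.eval_one] at hterm
    linear_combination hterm
  · have h0 := ascPochhammer_eval_ne_zero hb n
    have h1 := ascPochhammer_eval_ne_zero hb (n + 1)
    rw [ascPochhammer_succ_eval] at h1 ⊢
    have h2 := right_ne_zero_of_mul h1
    simp only [add_tsub_cancel_right]
    push_cast
    field_simp
    ring

theorem hasDerivAt_kummerOne_comp {b : ℝ} (hb : 0 < b) (c : ℂ) (x : ℝ) :
    HasDerivAt (fun y : ℝ => kummerOne b (c * y)) (c * deriv (kummerOne b) (c * x)) x := by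
  have h1 : HasDerivAt (fun w : ℂ => c * w) c (x : ℂ) := by
    simpa using (hasDerivAt_id (x : ℂ)).const_mul c
  have h2 := (differentiable_kummerOne hb (c * x)).hasDerivAt.comp (x : ℂ) h1
  rw [mul_comm] at h2
  exact h2.comp_ofReal

theorem analyticAt_kummerOne_comp {b : ℝ} (hb : 0 < b) (c : ℂ) (x : ℝ) :
    AnalyticAt ℝ (fun y : ℝ => kummerOne b (c * y)) x := by
  have h1 : AnalyticAt ℝ (kummerOne b) (c * x) :=
    ((differentiable_kummerOne hb).analyticAt (c * x)).restrictScalars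
  have h2 : AnalyticAt ℝ (fun y : ℝ => c * (y : ℂ)) x :=
    analyticAt_const.mul (Complex.ofRealCLM.analyticAt x)
  exact h1.fun_comp_of_eq h2 rfl

theorem Tkappa_kummerOne {κ : ℝ} (hκ : -1 < κ) (c : ℂ) (x : ℝ) :
    Tkappa κ (fun y : ℝ => kummerOne (κ + 1 : ℝ) (c * y)) x =
      c * kummerOne (κ + 1 : ℝ) (c * x) := by
  have hb : 0 < κ + 1 := by linarith
  have hb' : (κ : ℂ) + 1 ≠ 0 := by exact_mod_cast hb.ne'
  unfold Tkappa
  simp only [(hasDerivAt_kummerOne_comp hb c _).deriv, Complex.ofReal_zero, mul_zero,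
    kummerOne_zero hb, deriv_kummerOne_zero hb]
  split_ifs with hx
  · simp only [hx, Complex.ofReal_zero, mul_zero, kummerOne_zero hb]
    push_cast
    field_simp
    ring
  · have hx' : (x : ℂ) ≠ 0 := by exact_mod_cast hx
    have h := kummerOne_ode hb (c * x)
    push_cast at h ⊢
    field_simp
    linear_combination h

/-- An analytic solution of `x g' + κ g = c x g` with `g 0 = 0` vanishes near `0`. -/
theorem eventually_eq_zero_of_ode {κ : ℝ} (hκ : -1 < κ) (c : ℂ) {g : ℝ → ℂ}
    (hg : AnalyticAt ℝ g 0) (hg0 : g 0 = 0)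
    (hode : ∀ x : ℝ, x ≠ 0 → x * deriv g x + κ * g x = c * x * g x) :
    ∀ᶠ x in 𝓝 (0 : ℝ), g x = 0 := by
  by_contra hne
  obtain ⟨n, h, hh, hh0, hgh⟩ := hg.exists_eventuallyEq_pow_smul_nonzero_iff.2 hne
  simp only [sub_zero] at hgh
  obtain _ | n := n
  · have := hgh.self_of_nhds
    simp [hg0] at this
    exact hh0 this.symm
  have hlocal : ∀ᶠ x : ℝ in 𝓝[≠] 0,
      (n + 1 + κ) * h x + x * deriv h x = c * x * h x := by
    filter_upwards [hgh.eventually_nhds.filter_mono nhdsWithin_le_nhds,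
      hh.eventually_analyticAt.filter_mono nhdsWithin_le_nhds, self_mem_nhdsWithin]
      with x hx hax hx0
    have hx0' : (x : ℂ) ≠ 0 := by exact_mod_cast hx0
    have hpow : HasDerivAt (fun y : ℝ => (y : ℂ) ^ (n + 1)) ((n + 1) * (x : ℂ) ^ n) x := by
      simpa using (hasDerivAt_pow (n + 1) (x : ℂ)).comp_ofReal
    have hd := hpow.mul hax.differentiableAt.hasDerivAt
    have heq : g =ᶠ[𝓝 x] fun y : ℝ => (y : ℂ) ^ (n + 1) * h y := by
      filter_upwards [hx] with y hy
      rw [hy, Complex.real_smul, Complex.ofReal_pow]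
    have hderiv := (hd.congr_of_eventuallyEq heq).deriv
    have h1 := hode x hx0
    rw [hderiv, heq.self_of_nhds] at h1
    refine mul_left_cancel₀ (pow_ne_zero (n + 1) hx0') ?_
    linear_combination h1
  have hcoe : Tendsto (fun x : ℝ => (x : ℂ)) (𝓝[≠] 0) (𝓝 0) :=
    (Complex.continuous_ofReal.tendsto' 0 0 Complex.ofReal_zero).mono_left nhdsWithin_le_nhds
  have hht := hh.continuousAt.tendsto.mono_left (nhdsWithin_le_nhds (s := {0}ᶜ))
  have hht' := hh.deriv.continuousAt.tendsto.mono_left (nhdsWithin_le_nhds (s := {0}ᶜ))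
  have hlim := tendsto_nhds_unique
    (((hht.const_mul ((n : ℂ) + 1 + κ)).add (hcoe.mul hht')).congr' hlocal)
    ((hcoe.const_mul c).mul hht)
  simp only [zero_mul, mul_zero, add_zero] at hlim
  have hn : ((n : ℝ) + 1 + κ) ≠ 0 := by
    have : (0 : ℝ) ≤ n := n.cast_nonneg
    linarith
  exact mul_ne_zero (by exact_mod_cast hn) hh0 hlim

theorem Tkappa_eigenfunction_kummer (κ : ℝ) (hκ : -1 < κ) (lam : ℂ) (f : ℝ → ℂ) :
    ((∀ x : ℝ, AnalyticAt ℝ f x) ∧ f 0 = 1 ∧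
        (∀ x : ℝ, Tkappa (κ : ℂ) f x = Complex.I * lam * f x)) ↔
      (∀ x : ℝ, f x = ∑' n : ℕ,
        (Complex.I * lam * (x : ℂ)) ^ n / (ascPochhammer ℂ n).eval ((κ : ℂ) + 1)) := by
  have hb : 0 < κ + 1 := by linarith
  have hcast : (κ : ℂ) + 1 = ((κ + 1 : ℝ) : ℂ) := by push_cast; rfl
  rw [hcast]
  set c := Complex.I * lam
  set F : ℝ → ℂ := fun x => kummerOne (κ + 1 : ℝ) (c * x) with hF
  have hF0 : F 0 = 1 := by
    simp only [hF, Complex.ofReal_zero, mul_zero, kummerOne_zero hb]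
  constructor
  · rintro ⟨hf, hf0, hT⟩
    have hFan : ∀ x, AnalyticAt ℝ F x := analyticAt_kummerOne_comp hb c
    have hsub := eventually_eq_zero_of_ode hκ c ((hf 0).sub (hFan 0)) (by simp [hf0, hF0])
      fun x hx => by
        have hx' : (x : ℂ) ≠ 0 := by exact_mod_cast hx
        have h1 := hT x
        have h2 := Tkappa_kummerOne hκ c x
        rw [Tkappa, if_neg hx, hf0] at h1
        change Tkappa κ F x = c * F x at h2
        rw [Tkappa, if_neg hx, hF0] at h2
        field_simp at h1 h2
        rw [deriv_sub (hf x).differentiableAt (hFan x).differentiableAt]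
        simp only [Pi.sub_apply]
        linear_combination h1 - h2
    have heq : f = F := AnalyticOnNhd.eq_of_eventuallyEq (fun x _ => hf x) (fun x _ => hFan x)
      (hsub.mono fun x hx => sub_eq_zero.1 hx)
    exact fun x => congrFun heq x
  · intro hf
    obtain rfl : f = F := funext hf
    exact ⟨analyticAt_kummerOne_comp hb c, hF0, Tkappa_kummerOne hκ c⟩
end

section
/- For κ > 0 and f ∈ C^∞(ℝ), χ_κ f ∈ C^∞(ℝ), and for every n ∈ ℕ and a > 0 one has sup_{0≤k≤n, |x|≤a} |(χ_κ f)^{(k)}(x)| ≤ (1/Γ(κ+1)) sup_{0≤k≤n, |x|≤a} |f^{(k)}(x)|. Hence χ_κ is a continuous linear operator on C^∞(ℝ). -/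
/-- The one-variable intertwining operator `χ_κ`. -/
noncomputable def chiKappa (κ : ℝ) (f : ℝ → ℂ) (x : ℝ) : ℂ :=
  (Real.Gamma κ)⁻¹ • ∫ t in (0:ℝ)..1, ((1 - t) ^ (κ - 1) : ℝ) • f (t * x)

open MeasureTheory in
/-- Differentiation under the integral sign for a weighted mean of dilates. -/
theorem hasDerivAt_integral_dilate {w : ℝ → ℝ} (hw : IntervalIntegrable w volume 0 1)
    {f : ℝ → ℂ} (hf : ContDiff ℝ 1 f) (x : ℝ) :
    HasDerivAt (fun x : ℝ => ∫ t in (0:ℝ)..1, w t • f (t * x))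
      (∫ t in (0:ℝ)..1, (t * w t) • deriv f (t * x)) x := by
  have hf' : Continuous (deriv f) := hf.continuous_deriv le_rfl
  have hfd : Differentiable ℝ f := hf.differentiable one_ne_zero
  obtain ⟨C, hC⟩ := (isCompact_Icc (a := -(|x| + 1)) (b := |x| + 1)).exists_bound_of_continuousOn
    hf'.continuousOn
  have hfc : Continuous f := hfd.continuous
  have hint (y : ℝ) : IntervalIntegrable (fun t => w t • f (t * y)) volume 0 1 :=
    hw.smul_continuousOn (by fun_prop)
  have hint' : IntervalIntegrable (fun t => (t * w t) • deriv f (t * x)) volume 0 1 :=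
    (hw.continuousOn_mul continuousOn_id).smul_continuousOn (by fun_prop)
  refine (intervalIntegral.hasDerivAt_integral_of_dominated_loc_of_deriv_le
    (F' := fun y t => (t * w t) • deriv f (t * y)) (bound := fun t => |w t| * C)
    (Metric.ball_mem_nhds x one_pos)
    (Filter.Eventually.of_forall fun y => (hint y).def'.aestronglyMeasurable) (hint x)
    hint'.def'.aestronglyMeasurable (Filter.Eventually.of_forall ?_)
    (hw.abs.mul_const C) (Filter.Eventually.of_forall ?_)).2
  · intro t ht y hy
    rw [Set.uIoc_of_le zero_le_one] at ht
    have hy' : |y| ≤ |x| + 1 := by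
      rw [Metric.mem_ball, Real.dist_eq] at hy
      linarith [abs_sub_abs_le_abs_sub y x]
    have hty : |t * y| ≤ |x| + 1 := by
      rw [abs_mul, abs_of_pos ht.1]
      exact (mul_le_of_le_one_left (abs_nonneg y) ht.2).trans hy'
    rw [norm_smul, Real.norm_eq_abs, abs_mul, abs_of_pos ht.1]
    exact mul_le_mul (mul_le_of_le_one_left (abs_nonneg _) ht.2) (hC _ (abs_le.mp hty))
      (norm_nonneg _) (abs_nonneg _)
  · intro t _ y _
    have h := ((hfd (t * y)).hasDerivAt.scomp y ((hasDerivAt_id y).const_mul t)).const_smul (w t)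
    rwa [mul_one, smul_smul, mul_comm (w t)] at h

open MeasureTheory in
theorem iteratedDeriv_integral_dilate {w : ℝ → ℝ} (hw : IntervalIntegrable w volume 0 1)
    {f : ℝ → ℂ} (hf : ContDiff ℝ (⊤ : ℕ∞) f) (k : ℕ) :
    iteratedDeriv k (fun x : ℝ => ∫ t in (0:ℝ)..1, w t • f (t * x)) =
      fun x => ∫ t in (0:ℝ)..1, (t ^ k * w t) • iteratedDeriv k f (t * x) := by
  induction k with
  | zero => simp
  | succ k ih =>
    funext x
    have hk : ContDiff ℝ 1 (iteratedDeriv k f) := by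
      rw [iteratedDeriv_eq_iterate]
      exact (contDiff_infty.mp hf (1 + k)).iterate_deriv' 1 k
    rw [iteratedDeriv_succ, ih, (hasDerivAt_integral_dilate
      (hw.continuousOn_mul (continuous_pow k).continuousOn) hk x).deriv]
    simp only [iteratedDeriv_succ, pow_succ', mul_assoc]

open MeasureTheory in
theorem contDiff_integral_dilate {w : ℝ → ℝ} (hw : IntervalIntegrable w volume 0 1)
    {f : ℝ → ℂ} (hf : ContDiff ℝ (⊤ : ℕ∞) f) :
    ContDiff ℝ (⊤ : ℕ∞) (fun x : ℝ => ∫ t in (0:ℝ)..1, w t • f (t * x)) := by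
  refine contDiff_of_differentiable_iteratedDeriv fun k _ x => ?_
  have hk : ContDiff ℝ 1 (iteratedDeriv k f) := by
    rw [iteratedDeriv_eq_iterate]
    exact (contDiff_infty.mp hf (1 + k)).iterate_deriv' 1 k
  rw [iteratedDeriv_integral_dilate hw hf]
  exact (hasDerivAt_integral_dilate
    (hw.continuousOn_mul (continuous_pow k).continuousOn) hk x).differentiableAt

theorem intervalIntegrable_one_sub_rpow {κ : ℝ} (hκ : 0 < κ) :
    IntervalIntegrable (fun t : ℝ => (1 - t) ^ (κ - 1)) MeasureTheory.volume 0 1 := by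
  have h := (intervalIntegral.intervalIntegrable_rpow' (a := 1) (b := 0) (r := κ - 1)
    (by linarith)).comp_sub_left 1
  simpa using h

theorem integral_one_sub_rpow {κ : ℝ} (hκ : 0 < κ) :
    ∫ t in (0:ℝ)..1, (1 - t) ^ (κ - 1) = κ⁻¹ := by
  rw [intervalIntegral.integral_comp_sub_left (fun t : ℝ => t ^ (κ - 1)) 1,
    integral_rpow (Or.inl (by linarith))]
  simp [hκ.ne']

theorem chiKappa_smooth_and_seminorm_bound (κ : ℝ) (hκ : 0 < κ)
    (f : ℝ → ℂ) (hf : ContDiff ℝ (⊤ : ℕ∞) f) :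
    ContDiff ℝ (⊤ : ℕ∞) (chiKappa κ f) ∧
    ∀ (n : ℕ) (a : ℝ), 0 < a → ∀ k ≤ n, ∀ x : ℝ, |x| ≤ a →
      ‖iteratedDeriv k (chiKappa κ f) x‖ ≤
        (Real.Gamma (κ + 1))⁻¹ *
          sSup {r : ℝ | ∃ k' ≤ n, ∃ x' : ℝ, |x'| ≤ a ∧ r = ‖iteratedDeriv k' f x'‖} := by
  have hw₀ := intervalIntegrable_one_sub_rpow hκ
  have hw := hw₀.const_mul (Real.Gamma κ)⁻¹
  have hχ : chiKappa κ f = fun x => ∫ t in (0:ℝ)..1,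
      ((Real.Gamma κ)⁻¹ * (1 - t) ^ (κ - 1)) • f (t * x) := by
    funext x
    simp only [chiKappa, mul_smul, intervalIntegral.integral_smul]
  rw [hχ]
  refine ⟨contDiff_integral_dilate hw hf, fun n a _ k hk x hx => ?_⟩
  rw [iteratedDeriv_integral_dilate hw hf]
  set S := {r : ℝ | ∃ k' ≤ n, ∃ x' : ℝ, |x'| ≤ a ∧ r = ‖iteratedDeriv k' f x'‖} with hS
  have hbdd : BddAbove S := by
    have hunion : S = ⋃ j ∈ Set.Iic n, (fun y => ‖iteratedDeriv j f y‖) '' Set.Icc (-a) a := by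
      ext r
      simp [hS, abs_le, eq_comm, and_assoc]
    rw [hunion, (Set.finite_Iic n).bddAbove_biUnion]
    exact fun j _ => (isCompact_Icc.image
      (hf.continuous_iteratedDeriv j (by exact_mod_cast le_top)).norm).bddAbove
  have hΓ : 0 < Real.Gamma κ := Real.Gamma_pos_of_pos hκ
  have key := intervalIntegral.norm_integral_le_of_norm_le (μ := MeasureTheory.volume)
    (f := fun t => (t ^ k * ((Real.Gamma κ)⁻¹ * (1 - t) ^ (κ - 1))) • iteratedDeriv k f (t * x))
    (g := fun t => ((Real.Gamma κ)⁻¹ * (1 - t) ^ (κ - 1)) * sSup S) zero_le_one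
    (Filter.Eventually.of_forall ?_) (hw.mul_const _)
  · refine key.trans_eq ?_
    rw [intervalIntegral.integral_mul_const, intervalIntegral.integral_const_mul,
      integral_one_sub_rpow hκ, Real.Gamma_add_one hκ.ne', mul_inv, mul_comm κ⁻¹]
  · intro t ht
    have hpos : 0 ≤ (Real.Gamma κ)⁻¹ * (1 - t) ^ (κ - 1) :=
      mul_nonneg (inv_nonneg.mpr hΓ.le) (Real.rpow_nonneg (by linarith [ht.2]) _)
    have htx : |t * x| ≤ a := by
      rw [abs_mul, abs_of_pos ht.1]
      exact (mul_le_of_le_one_left (abs_nonneg x) ht.2).trans hx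
    rw [norm_smul, Real.norm_of_nonneg (mul_nonneg (pow_nonneg ht.1.le k) hpos)]
    exact mul_le_mul (mul_le_of_le_one_left hpos (pow_le_one₀ ht.1.le ht.2))
      (le_csSup hbdd ⟨k, hk, _, htx, rfl⟩) (norm_nonneg _) hpos
end

section
/- Let R' = {α_1, …, α_n} be a family of pairwise orthogonal nonzero vectors in ℝ^N, κ_1, …, κ_n ∈ ℂ, and for ξ ∈ ℝ^N define (T_ξ f)(x) = ∂_ξ f(x) + Σ_{j=1}^n κ_j ⟨α_j, ξ⟩ (f(x) - f(τ_{α_j} x))/⟨x, α_j⟩ on polynomials (or smooth functions). Then for all ξ, η ∈ ℝ^N, T_ξ ∘ T_η = T_η ∘ T_ξ. -/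
open RealInnerProductSpace

/-- The Dunkl-type operator `T_ξ` associated to a family of pairwise orthogonal
roots `α` and multiplicity parameters `κ`.  The difference quotient
`(f(x) - f(τ_{α_j} x)) / ⟨x, α_j⟩` is written via its (smooth) integral
representation `(1/|α_j|²) ∫₀¹ ∂_{α_j} f(x - t (⟨x,α_j⟩/|α_j|²) α_j) dt`. -/
noncomputable def Txi {N n : ℕ} (α : Fin n → EuclideanSpace ℝ (Fin N))
    (κ : Fin n → ℂ) (ξ : EuclideanSpace ℝ (Fin N))
    (f : EuclideanSpace ℝ (Fin N) → ℂ) (x : EuclideanSpace ℝ (Fin N)) : ℂ :=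
  fderiv ℝ f x ξ + ∑ j, κ j *
    ((⟪α j, ξ⟫ / ‖α j‖ ^ 2 : ℝ) •
      ∫ t in (0:ℝ)..1,
        fderiv ℝ f (x - ((t * ⟪x, α j⟫) / ‖α j‖ ^ 2) • α j) (α j))

open MeasureTheory Metric

section

variable {V : Type*} [NormedAddCommGroup V] [NormedSpace ℝ V] [FiniteDimensional ℝ V]
  {G : Type*} [NormedAddCommGroup G] [NormedSpace ℝ G]

/-- Differentiation under an interval integral for jointly continuous data. -/
theorem hasFDerivAt_intervalIntegral_of_continuous {F : V → ℝ → G} {F' : V → ℝ → V →L[ℝ] G}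
    (hF : Continuous (Function.uncurry F)) (hF' : Continuous (Function.uncurry F'))
    (hd : ∀ x t, HasFDerivAt (fun y => F y t) (F' x t) x) (a b : ℝ) (x : V) :
    HasFDerivAt (fun y => ∫ t in a..b, F y t) (∫ t in a..b, F' x t) x := by
  have hFt (y : V) : Continuous (F y) := hF.comp (Continuous.prodMk_right y)
  have hF't (y : V) : Continuous (F' y) := hF'.comp (Continuous.prodMk_right y)
  have : ProperSpace V := FiniteDimensional.proper ℝ V
  obtain ⟨C, hC⟩ := ((isCompact_closedBall x 1).prod
    (isCompact_uIcc (a := a) (b := b))).exists_bound_of_continuousOn hF'.continuousOn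
  refine intervalIntegral.hasFDerivAt_integral_of_dominated_of_fderiv_le (bound := fun _ => C)
    (closedBall_mem_nhds x one_pos) (.of_forall fun y => (hFt y).aestronglyMeasurable)
    ((hFt x).intervalIntegrable a b) (hF't x).aestronglyMeasurable
    (.of_forall fun t ht y hy => ?_) intervalIntegrable_const (.of_forall fun t _ y _ => hd y t)
  exact hC (y, t) ⟨hy, Set.uIoc_subset_uIcc ht⟩

end

section

variable {V : Type*} [NormedAddCommGroup V] [InnerProductSpace ℝ V]

/-- The linear map `x ↦ x - t (⟨x, a⟩ / |a|²) a`, interpolating between the identity and the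
orthogonal projection along `a`. -/
noncomputable def partialProj (a : V) (t : ℝ) : V →L[ℝ] V :=
  ContinuousLinearMap.id ℝ V - t • (‖a‖ ^ 2)⁻¹ • (innerSL ℝ a).smulRight a

theorem partialProj_apply (a : V) (t : ℝ) (x : V) :
    partialProj a t x = x - (t * (⟪a, x⟫ / ‖a‖ ^ 2)) • a := by
  simp [partialProj, smul_smul, div_eq_inv_mul, mul_assoc]

theorem continuous_partialProj (a : V) : Continuous (partialProj a) := by
  unfold partialProj
  fun_prop

theorem continuous_partialProj_apply (a : V) :
    Continuous fun p : V × ℝ => partialProj a p.2 p.1 :=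
  ((continuous_partialProj a).comp continuous_snd).clm_apply continuous_fst

theorem partialProj_apply_of_inner_eq_zero {a x : V} (h : ⟪a, x⟫ = 0) (t : ℝ) :
    partialProj a t x = x := by
  simp [partialProj_apply, h]

theorem partialProj_comm {a b : V} (h : ⟪a, b⟫ = 0) (s t : ℝ) (x : V) :
    partialProj a s (partialProj b t x) = partialProj b t (partialProj a s x) := by
  have h' : ⟪b, a⟫ = 0 := by rw [real_inner_comm, h]
  simp only [partialProj_apply, inner_sub_right, inner_smul_right, h, h']
  simp only [mul_zero, sub_zero]
  abel

/-- The average of `∂_a f` over the segment from `x` to its orthogonal projection along `a`. -/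
noncomputable def segmentAverage (a : V) (f : V → ℂ) (x : V) : ℂ :=
  ∫ t in (0 : ℝ)..1, fderiv ℝ f (partialProj a t x) a

theorem continuous_fderiv_partialProj {f : V → ℂ} (hf : ContDiff ℝ 1 f) (a v : V) :
    Continuous fun p : V × ℝ => fderiv ℝ f (partialProj a p.2 p.1) v :=
  ((hf.continuous_fderiv one_ne_zero).comp (continuous_partialProj_apply a)).clm_apply
    continuous_const

theorem intervalIntegrable_fderiv_partialProj {f : V → ℂ} (hf : ContDiff ℝ 1 f) (a v x : V)
    (c d : ℝ) :
    IntervalIntegrable (fun t => fderiv ℝ f (partialProj a t x) v) volume c d :=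
  ((continuous_fderiv_partialProj hf a v).comp (Continuous.prodMk_right x)).intervalIntegrable _ _

theorem segmentAverage_add {f g : V → ℂ} (hf : ContDiff ℝ 1 f) (hg : ContDiff ℝ 1 g) (a x : V) :
    segmentAverage a (fun y => f y + g y) x = segmentAverage a f x + segmentAverage a g x := by
  unfold segmentAverage
  rw [← intervalIntegral.integral_add (intervalIntegrable_fderiv_partialProj hf a a x _ _)
    (intervalIntegrable_fderiv_partialProj hg a a x _ _)]
  congr 1 with t
  rw [fderiv_fun_add (hf.differentiable one_ne_zero _) (hg.differentiable one_ne_zero _)]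
  rfl

theorem segmentAverage_sum {ι : Type*} (s : Finset ι) (c : ι → ℂ) {g : ι → V → ℂ}
    (hg : ∀ i, ContDiff ℝ 1 (g i)) (a x : V) :
    segmentAverage a (fun y => ∑ i ∈ s, c i * g i y) x =
      ∑ i ∈ s, c i * segmentAverage a (g i) x := by
  unfold segmentAverage
  simp_rw [← intervalIntegral.integral_const_mul]
  rw [← intervalIntegral.integral_finsetSum fun i _ =>
    (intervalIntegrable_fderiv_partialProj (hg i) a a x _ _).const_mul _]
  congr 1 with t
  rw [fderiv_fun_sum fun i _ => ((hg i).differentiable one_ne_zero _).const_mul _]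
  simp [fderiv_const_mul ((hg _).differentiable one_ne_zero _)]

theorem contDiff_fderiv_apply {f : V → ℂ} (hf : ContDiff ℝ 2 f) (v : V) :
    ContDiff ℝ 1 fun y => fderiv ℝ f y v :=
  (hf.fderiv_right (by norm_num)).clm_apply contDiff_const

theorem fderiv_fderiv_apply_comm {f : V → ℂ} (hf : ContDiff ℝ 2 f) (u v x : V) :
    fderiv ℝ (fun y => fderiv ℝ f y u) x v = fderiv ℝ (fun y => fderiv ℝ f y v) x u := by
  have hd : DifferentiableAt ℝ (fderiv ℝ f) x :=
    (hf.fderiv_right (m := 1) (by norm_num)).differentiable one_ne_zero x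
  have hs : IsSymmSndFDerivAt ℝ f x := hf.contDiffAt.isSymmSndFDerivAt (by simp)
  rw [fderiv_clm_apply hd (differentiableAt_const _), fderiv_clm_apply hd (differentiableAt_const _)]
  simpa using hs v u

theorem continuous_fderiv_comp_partialProj {g : V → ℂ} (hg : ContDiff ℝ 1 g) (a : V) :
    Continuous fun p : V × ℝ =>
      (fderiv ℝ g (partialProj a p.2 p.1)).comp (partialProj a p.2) :=
  ((hg.continuous_fderiv one_ne_zero).comp (continuous_partialProj_apply a)).clm_comp
    ((continuous_partialProj a).comp continuous_snd)

variable [FiniteDimensional ℝ V]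

theorem hasFDerivAt_segmentAverage {f : V → ℂ} (hf : ContDiff ℝ 2 f) (a x : V) :
    HasFDerivAt (segmentAverage a f)
      (∫ t in (0 : ℝ)..1, (fderiv ℝ (fun y => fderiv ℝ f y a) (partialProj a t x)).comp
        (partialProj a t)) x := by
  have hg := contDiff_fderiv_apply hf a
  refine hasFDerivAt_intervalIntegral_of_continuous
    (F := fun y t => fderiv ℝ f (partialProj a t y) a)
    (F' := fun y t => (fderiv ℝ (fun y => fderiv ℝ f y a) (partialProj a t y)).comp
      (partialProj a t))
    (continuous_fderiv_partialProj (hf.of_le (by norm_num)) a a)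
    (continuous_fderiv_comp_partialProj hg a) (fun y t => ?_) 0 1 x
  exact ((hg.differentiable one_ne_zero _).hasFDerivAt).comp y (partialProj a t).hasFDerivAt

theorem contDiff_segmentAverage {f : V → ℂ} (hf : ContDiff ℝ 2 f) (a : V) :
    ContDiff ℝ 1 (segmentAverage a f) := by
  refine contDiff_one_iff_hasFDerivAt.2 ⟨_, ?_, hasFDerivAt_segmentAverage hf a⟩
  exact intervalIntegral.continuous_parametric_intervalIntegral_of_continuous'
    (continuous_fderiv_comp_partialProj (contDiff_fderiv_apply hf a) a) 0 1

theorem fderiv_segmentAverage_apply {f : V → ℂ} (hf : ContDiff ℝ 2 f) (a x v : V) :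
    fderiv ℝ (segmentAverage a f) x v =
      ∫ t in (0 : ℝ)..1, fderiv ℝ (fun y => fderiv ℝ f y a) (partialProj a t x)
        (partialProj a t v) := by
  rw [(hasFDerivAt_segmentAverage hf a x).fderiv, ContinuousLinearMap.intervalIntegral_apply]
  · rfl
  · exact ((continuous_fderiv_comp_partialProj (contDiff_fderiv_apply hf a) a).comp
      (Continuous.prodMk_right x)).intervalIntegrable _ _

theorem fderiv_segmentAverage_eq_sub {f : V → ℂ} (hf : ContDiff ℝ 2 f) (a x v : V) :
    fderiv ℝ (segmentAverage a f) x v =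
      segmentAverage a (fun y => fderiv ℝ f y v) x - (⟪a, v⟫ / ‖a‖ ^ 2 : ℝ) *
        ∫ t in (0 : ℝ)..1, (t : ℂ) * fderiv ℝ (fun y => fderiv ℝ f y a) (partialProj a t x) a := by
  have hg := contDiff_fderiv_apply hf
  rw [fderiv_segmentAverage_apply hf, segmentAverage, ← intervalIntegral.integral_const_mul,
    ← intervalIntegral.integral_sub (intervalIntegrable_fderiv_partialProj (hg v) a a x _ _)]
  · congr 1 with t
    rw [fderiv_fderiv_apply_comm hf v a, partialProj_apply a t v, map_sub, map_smul,
      Complex.real_smul]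
    push_cast
    ring
  · exact (((Complex.continuous_ofReal.mul ((continuous_fderiv_partialProj (hg a) a a).comp
      (Continuous.prodMk_right x))).const_mul _).intervalIntegrable _ _)

theorem segmentAverage_comm {f : V → ℂ} (hf : ContDiff ℝ 2 f) {a b : V} (h : ⟪a, b⟫ = 0) (x : V) :
    segmentAverage a (segmentAverage b f) x = segmentAverage b (segmentAverage a f) x := by
  have h' : ⟪b, a⟫ = 0 := by rw [real_inner_comm, h]
  rw [segmentAverage, segmentAverage]
  simp_rw [fderiv_segmentAverage_apply hf, partialProj_apply_of_inner_eq_zero h,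
    partialProj_apply_of_inner_eq_zero h']
  rw [intervalIntegral_intervalIntegral_swap]
  · congr 1 with t
    congr 1 with s
    rw [fderiv_fderiv_apply_comm hf, partialProj_comm h]
  · have hc : Continuous fun p : ℝ × ℝ =>
        fderiv ℝ (fun y => fderiv ℝ f y b) (partialProj b p.2 (partialProj a p.1 x)) a :=
      (continuous_fderiv_partialProj (contDiff_fderiv_apply hf b) b a).comp
        (((continuous_partialProj_apply a).comp
          (continuous_const.prodMk continuous_fst)).prodMk continuous_snd)
    exact (hc.continuousOn.integrableOn_compact (isCompact_uIcc.prod isCompact_uIcc)).mono_set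
      (Set.prod_mono Set.uIoc_subset_uIcc Set.uIoc_subset_uIcc)

end

section

variable {N n : ℕ} {α : Fin n → EuclideanSpace ℝ (Fin N)} (κ : Fin n → ℂ)
  (ξ η : EuclideanSpace ℝ (Fin N)) {f : EuclideanSpace ℝ (Fin N) → ℂ}

theorem Txi_eq_segmentAverage (α : Fin n → EuclideanSpace ℝ (Fin N))
    (f : EuclideanSpace ℝ (Fin N) → ℂ) :
    Txi α κ ξ f = fun x => fderiv ℝ f x ξ +
      ∑ j, (κ j * (⟪α j, ξ⟫ / ‖α j‖ ^ 2 : ℝ)) * segmentAverage (α j) f x := by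
  ext x
  simp_rw [Txi, segmentAverage, partialProj_apply, Complex.real_smul, mul_assoc, mul_div_assoc,
    real_inner_comm x]

theorem Txi_Txi (α : Fin n → EuclideanSpace ℝ (Fin N)) (hf : ContDiff ℝ 2 f)
    (x : EuclideanSpace ℝ (Fin N)) :
    Txi α κ ξ (Txi α κ η f) x =
      fderiv ℝ (fun y => fderiv ℝ f y η) x ξ +
      ∑ j, (κ j * (⟪α j, η⟫ / ‖α j‖ ^ 2 : ℝ)) * fderiv ℝ (segmentAverage (α j) f) x ξ +
      ∑ i, (κ i * (⟪α i, ξ⟫ / ‖α i‖ ^ 2 : ℝ)) *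
        segmentAverage (α i) (fun y => fderiv ℝ f y η) x +
      ∑ i, ∑ j, (κ i * (⟪α i, ξ⟫ / ‖α i‖ ^ 2 : ℝ)) * ((κ j * (⟪α j, η⟫ / ‖α j‖ ^ 2 : ℝ)) *
        segmentAverage (α i) (segmentAverage (α j) f) x) := by
  have hA (j : Fin n) := contDiff_segmentAverage hf (α j)
  have hg := contDiff_fderiv_apply hf η
  have hd (j : Fin n) := (hA j).differentiable one_ne_zero x
  rw [Txi_eq_segmentAverage κ ξ, Txi_eq_segmentAverage κ η]
  simp only
  rw [fderiv_fun_add (hg.differentiable one_ne_zero x)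
    (.fun_sum fun j _ => (hd j).const_mul _), fderiv_fun_sum fun j _ => (hd j).const_mul _]
  simp_rw [segmentAverage_add hg (ContDiff.sum fun j _ => contDiff_const.mul (hA j)),
    segmentAverage_sum _ _ hA, fderiv_const_mul (hd _), mul_add, Finset.sum_add_distrib,
    Finset.mul_sum]
  simp [add_assoc]

end

theorem Txi_commute {N n : ℕ} (α : Fin n → EuclideanSpace ℝ (Fin N))
    (hα : ∀ j, α j ≠ 0) (horth : ∀ i j, i ≠ j → ⟪α i, α j⟫ = 0)
    (κ : Fin n → ℂ) (f : EuclideanSpace ℝ (Fin N) → ℂ) (hf : ContDiff ℝ (⊤ : ℕ∞) f)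
    (ξ η : EuclideanSpace ℝ (Fin N)) :
    ∀ x, Txi α κ ξ (Txi α κ η f) x = Txi α κ η (Txi α κ ξ f) x := by
  intro x
  have hf2 : ContDiff ℝ 2 f := contDiff_infty.1 hf 2
  have hcomm (i j : Fin n) : segmentAverage (α i) (segmentAverage (α j) f) x =
      segmentAverage (α j) (segmentAverage (α i) f) x := by
    rcases eq_or_ne i j with rfl | hij
    · rfl
    · exact segmentAverage_comm hf2 (horth i j hij) x
  rw [Txi_Txi κ ξ η α hf2, Txi_Txi κ η ξ α hf2, fderiv_fderiv_apply_comm hf2 η ξ]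
  congr 1
  · simp_rw [fderiv_segmentAverage_eq_sub hf2, add_assoc, ← Finset.sum_add_distrib]
    congr 1
    refine Finset.sum_congr rfl fun j _ => ?_
    ring
  · rw [Finset.sum_comm]
    refine Finset.sum_congr rfl fun i _ => Finset.sum_congr rfl fun j _ => ?_
    rw [hcomm j i]
    ring
end
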